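/- Let p be a prime and let 𝔽_{p²} be the field with p² elements. Then: (a) there exists an injective group homomorphism f : ℤ/pℤ × ℤ/pℤ → GL_2(𝔽_{p²}); and (b) for every injective group homomorphism f : ℤ/pℤ × ℤ/pℤ → GL_2(𝔽_{p²}), there is no group homomorphism g : ℤ/pℤ × ℤ/pℤ → GL_2(W₂(𝔽_{p²})) whose composition with the natural map GL_2(W₂(𝔽_{p²})) → GL_2(𝔽_{p²}) equals f. -/

import Mathlib

/-- The natural reduction ring homomorphism `W₂(k) → k` from length-two `p`-typical
Witt vectors to `k`, given by the zeroth coefficient. -/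
noncomputable def wittReduce (p : ℕ) [Fact p.Prime] (k : Type*) [CommRing k] :
    TruncatedWittVector p 2 k →+* k :=
  RingHom.liftOfRightInverse (WittVector.truncate 2) TruncatedWittVector.out
    TruncatedWittVector.truncateFun_out
    ⟨WittVector.constantCoeff, fun x hx => by
      rw [WittVector.mem_ker_truncate] at hx
      simpa [RingHom.mem_ker] using hx 0 (by norm_num)⟩

/-- A finite group `G` has property `L_p` if every homomorphism `G → GL_n(k)`, for `k` a
finite field of characteristic `p`, lifts to `GL_n(W₂(k))`. -/
def HasLp (p : ℕ) [Fact p.Prime] (G : Type*) [Group G] : Prop :=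
  ∀ (n : ℕ), 1 ≤ n → ∀ (k : Type) [Field k] [Fintype k] [CharP k p],
    ∀ f : G →* GL (Fin n) k,
      ∃ g : G →* GL (Fin n) (TruncatedWittVector p 2 k),
        (Matrix.GeneralLinearGroup.map (wittReduce p k)).comp g = f

/-- A group has property `L` if it has property `L_p` for every prime `p`. -/
def HasL (G : Type*) [Group G] : Prop :=
  ∀ (p : ℕ) [Fact p.Prime], HasLp p G

open Matrix

section Unipotent

variable {R k : Type*} [CommRing R] [Field k]

theorem Matrix.sq_eq_trace_smul_sub_det_smul_one (N : Matrix (Fin 2) (Fin 2) R) :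
    N ^ 2 = N.trace • N - N.det • 1 := by
  ext i j
  fin_cases i <;> fin_cases j <;>
    simp [pow_two, Matrix.mul_apply, Fin.sum_univ_two, trace_fin_two, det_fin_two] <;> ring

/-- A matrix of order dividing the characteristic is unipotent. -/
theorem Matrix.trace_det_sub_one_eq_zero {p : ℕ} [Fact p.Prime] [CharP k p]
    {B : Matrix (Fin 2) (Fin 2) k} (hB : B ^ p = 1) :
    (B - 1).trace = 0 ∧ (B - 1).det = 0 := by
  have h : (B - 1) ^ p = 0 := by
    rw [sub_pow_char_of_commute (p := p) (Commute.one_right B), hB, one_pow, sub_self]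
  exact ⟨(Matrix.isNilpotent_trace_of_isNilpotent ⟨p, h⟩).eq_zero,
    eq_zero_of_pow_eq_zero (n := p) (by rw [← det_pow, h, det_zero])⟩

theorem Matrix.offDiag_ne_zero_of_trace_det_eq_zero {N : Matrix (Fin 2) (Fin 2) k}
    (ht : N.trace = 0) (hd : N.det = 0) (hN : N ≠ 0) : N 0 1 ≠ 0 ∨ N 1 0 ≠ 0 := by
  by_contra! h
  rw [trace_fin_two] at ht
  rw [det_fin_two, h.1, h.2] at hd
  apply hN
  have h0 : N 0 0 = 0 := by
    have : N 0 0 ^ 2 = 0 := by linear_combination N 0 0 * ht - hd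
    exact pow_eq_zero_iff two_ne_zero |>.mp this
  have h1 : N 1 1 = 0 := by linear_combination ht - h0
  ext i j
  fin_cases i <;> fin_cases j <;> simp [h, h0, h1]

theorem one_add_pow_eq_of_pow_four_eq_zero {A : Type*} [Ring A] {N : A} (h : N ^ 4 = 0) (n : ℕ) :
    (1 + N) ^ n = 1 + (n : A) * N + (n.choose 2 : A) * N ^ 2 + (n.choose 3 : A) * N ^ 3 := by
  induction n with
  | zero => simp
  | succ n ih =>
    rw [pow_succ, ih, Nat.choose_succ_succ' n 1, Nat.choose_succ_succ' n 2]
    have h4 : N ^ 3 * N = 0 := by rw [← pow_succ, h]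
    simp only [mul_add, add_mul, mul_assoc, h4, ← pow_succ, ← pow_two, Nat.choose_one_right]
    push_cast
    simp only [one_pow, mul_one, one_mul, mul_zero, add_mul]
    abel

variable {φ : R →+* k}

theorem isUnit_of_map_ne_zero (hφ : Function.Surjective φ)
    (hsq : ∀ x y, φ x = 0 → φ y = 0 → x * y = 0) {x : R} (hx : φ x ≠ 0) : IsUnit x := by
  obtain ⟨s, hs⟩ := hφ (φ x)⁻¹
  have he : φ (x * s - 1) = 0 := by simp [hs, hx]
  exact .of_mul_eq_one (s * (2 - x * s)) (by linear_combination -hsq _ _ he he)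

/-- A unipotent element of order `p` over a square-zero thickening in which `p` does not vanish
forces `p ≤ 3` and determines the trace (`p = 2`) or determinant (`p = 3`) of its nilpotent
part. -/
theorem trace_or_det_of_one_add_pow_eq_one {p : ℕ} [Fact p.Prime] [CharP k p]
    (hφ : Function.Surjective φ) (hsq : ∀ x y, φ x = 0 → φ y = 0 → x * y = 0)
    (hp : ∀ r, (p : R) * r = 0 → φ r = 0)
    {N : Matrix (Fin 2) (Fin 2) R} (ht : φ N.trace = 0) (hd : φ N.det = 0)
    (hN : φ (N 0 1) ≠ 0 ∨ φ (N 1 0) ≠ 0) (h1 : (1 + N) ^ p = 1) :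
    (p = 2 ∧ N.trace = -2) ∨ (p = 3 ∧ N.det = 3) := by
  obtain ⟨i, j, hij, hu⟩ : ∃ i j, i ≠ j ∧ φ (N i j) ≠ 0 := by
    rcases hN with h | h
    · exact ⟨0, 1, by decide, h⟩
    · exact ⟨1, 0, by decide, h⟩
  have hunit := isUnit_of_map_ne_zero hφ hsq hu
  have h2 := N.sq_eq_trace_smul_sub_det_smul_one
  have h3 : N ^ 3 = -(N.det • N) := by
    rw [pow_succ, h2, sub_mul, smul_mul_assoc, ← pow_two, h2, smul_sub, smul_smul, smul_smul,
      hsq _ _ ht ht, hsq _ _ ht hd]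
    simp
  have h4 : N ^ 4 = 0 := by
    rw [pow_succ, h3, neg_mul, smul_mul_assoc, ← pow_two, h2, smul_sub, smul_smul, smul_smul,
      hsq _ _ hd ht, hsq _ _ hd hd]
    simp
  have hpk : φ (p : R) = 0 := by simp
  have hexp : (p : R) * N i j + (p.choose 2 : R) * (N.trace * N i j)
      - (p.choose 3 : R) * (N.det * N i j) = 0 := by
    have h := congrFun (congrFun
      ((one_add_pow_eq_of_pow_four_eq_zero h4 p).symm.trans h1) i) j
    simpa [h2, h3, hij, ← nsmul_eq_mul, Matrix.smul_apply, sub_eq_add_neg] using h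
  have hpp : p.Prime := Fact.out
  obtain rfl | hp2 := eq_or_ne p 2
  · refine .inl ⟨rfl, ?_⟩
    norm_num at hexp
    have : N i j * (N.trace + 2) = 0 := by linear_combination hexp
    linear_combination hunit.mul_right_eq_zero.mp this
  obtain ⟨c, hc⟩ : p ∣ p.choose 2 :=
    hpp.dvd_choose_self two_ne_zero (lt_of_le_of_ne hpp.two_le hp2.symm)
  have hpt := hsq _ _ hpk ht
  rw [hc] at hexp
  push_cast at hexp
  obtain rfl | hp3 := eq_or_ne p 3
  · refine .inr ⟨rfl, ?_⟩
    norm_num at hexp hpt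
    have : N i j * (N.det - 3) = 0 := by linear_combination -hexp + c * N i j * hpt
    linear_combination hunit.mul_right_eq_zero.mp this
  · obtain ⟨d, hd'⟩ : p ∣ p.choose 3 :=
      hpp.dvd_choose_self three_ne_zero (by have := hpp.two_le; omega)
    rw [hd'] at hexp
    push_cast at hexp
    exact absurd (hp _ (by
      linear_combination hexp - c * N i j * hpt + d * N i j * hsq _ _ hpk hd)) hu

/-- A matrix commuting with one having a unit off-diagonal entry is a linear polynomial in it. -/
theorem Matrix.eq_smul_add_smul_one_of_commute {M N : Matrix (Fin 2) (Fin 2) R}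
    (h : Commute M N) (hM : IsUnit (M 0 1) ∨ IsUnit (M 1 0)) :
    ∃ a b : R, N = a • M + b • 1 := by
  have h00 := congrFun (congrFun h.eq 0) 0
  have h01 := congrFun (congrFun h.eq 0) 1
  have h10 := congrFun (congrFun h.eq 1) 0
  simp only [Matrix.mul_apply, Fin.sum_univ_two] at h00 h01 h10
  rcases hM with hM | hM
  · obtain ⟨c, hc⟩ := hM.exists_right_inv
    refine ⟨N 0 1 * c, N 0 0 - N 0 1 * c * M 0 0, ?_⟩
    ext i j
    fin_cases i <;> fin_cases j <;> simp
    · linear_combination -N 0 1 * hc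
    · linear_combination -N 1 0 * hc + c * h00
    · linear_combination (N 0 0 - N 1 1) * hc + c * h01
  · obtain ⟨c, hc⟩ := hM.exists_right_inv
    refine ⟨N 1 0 * c, N 0 0 - N 1 0 * c * M 0 0, ?_⟩
    ext i j
    fin_cases i <;> fin_cases j <;> simp
    · linear_combination -N 0 1 * hc - c * h00
    · linear_combination -N 1 0 * hc
    · linear_combination (N 0 0 - N 1 1) * hc - c * h10

/-- Over a square-zero thickening in which `p` does not vanish, two commuting matrices of order
`p` have reductions that are equal or mutually inverse. -/
theorem map_eq_or_mul_eq_one_of_commute {p : ℕ} [Fact p.Prime] [CharP k p]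
    (hφ : Function.Surjective φ) (hsq : ∀ x y, φ x = 0 → φ y = 0 → x * y = 0)
    (hp : ∀ r, (p : R) * r = 0 → φ r = 0)
    {A B : Matrix (Fin 2) (Fin 2) R} (hAB : Commute A B) (hA : A ^ p = 1) (hB : B ^ p = 1)
    (hA1 : φ.mapMatrix A ≠ 1) (hB1 : φ.mapMatrix B ≠ 1) :
    φ.mapMatrix B = φ.mapMatrix A ∨ φ.mapMatrix A * φ.mapMatrix B = 1 := by
  have key (X : Matrix (Fin 2) (Fin 2) R) (hX : X ^ p = 1) (hX1 : φ.mapMatrix X ≠ 1) :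
      φ (X - 1).trace = 0 ∧ φ (X - 1).det = 0 ∧
        (φ ((X - 1) 0 1) ≠ 0 ∨ φ ((X - 1) 1 0) ≠ 0) ∧
        ((p = 2 ∧ (X - 1).trace = -2) ∨ (p = 3 ∧ (X - 1).det = 3)) := by
    have hm : φ.mapMatrix (X - 1) = φ.mapMatrix X - 1 := by rw [map_sub, map_one]
    obtain ⟨ht, hd⟩ := Matrix.trace_det_sub_one_eq_zero (B := φ.mapMatrix X) (p := p)
      (by rw [← map_pow, hX, map_one])
    rw [← hm] at ht hd
    have ho := Matrix.offDiag_ne_zero_of_trace_det_eq_zero ht hd (by rwa [hm, sub_ne_zero])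
    rw [← RingHom.map_det] at hd
    have ht' : φ (X - 1).trace = 0 := by
      rw [AddMonoidHom.map_trace]; exact ht
    exact ⟨ht', hd, ho, trace_or_det_of_one_add_pow_eq_one hφ hsq hp ht' hd ho
      (by rwa [add_sub_cancel])⟩
  obtain ⟨hAt, hAd, hAo, hA'⟩ := key A hA hA1
  obtain ⟨hBt, hBd, -, hB'⟩ := key B hB hB1
  have hcomm : Commute (A - 1) (B - 1) :=
    (hAB.sub_left (Commute.one_left B)).sub_right (Commute.one_right _)
  obtain ⟨a, b, hab⟩ := Matrix.eq_smul_add_smul_one_of_commute hcomm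
    (hAo.imp (isUnit_of_map_ne_zero hφ hsq) (isUnit_of_map_ne_zero hφ hsq))
  have htr : (B - 1).trace = a * (A - 1).trace + 2 * b := by
    rw [hab]; simp [trace_add, trace_smul, -trace_sub]; ring
  have hdet : (B - 1).det = a ^ 2 * (A - 1).det + a * b * (A - 1).trace + b ^ 2 := by
    rw [hab]; simp [det_fin_two, trace_fin_two]; ring
  have hb : φ b = 0 := by
    have h := congrArg φ hdet
    simp only [map_add, map_mul, map_pow, hAt, hBd, hAd, mul_zero, zero_add] at h
    exact pow_eq_zero_iff two_ne_zero |>.mp h.symm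
  have hpk : φ (p : R) = 0 := by simp
  have hB_eq : φ.mapMatrix B = 1 + φ a • (φ.mapMatrix A - 1) := by
    have h := congrArg φ.mapMatrix hab
    have h' : φ.mapMatrix (a • (A - 1) + b • 1) = φ a • (φ.mapMatrix A - 1) := by
      rw [← map_one φ.mapMatrix, ← map_sub]
      ext i j
      simp [hb]
    rw [h', map_sub, map_one] at h
    rw [← h, add_sub_cancel]
  have hsqA : (φ.mapMatrix A - 1) ^ 2 = 0 := by
    rw [Matrix.sq_eq_trace_smul_sub_det_smul_one]
    have hd : (φ.mapMatrix A - 1).det = 0 := by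
      rw [← hAd, RingHom.map_det, map_sub, map_one]
    have ht : (φ.mapMatrix A - 1).trace = 0 := by
      rw [← hAt, AddMonoidHom.map_trace, ← RingHom.mapMatrix_apply, map_sub, map_one]
    rw [hd, ht, zero_smul, zero_smul, sub_zero]
  rcases hA' with ⟨rfl, hA2⟩ | ⟨rfl, hA3⟩
  · have hB2 : (B - 1).trace = -2 := by simpa using hB'
    left
    have h2b := hsq _ _ hpk hb
    push_cast at h2b
    have := hp (a - 1) (by push_cast; linear_combination htr - hB2 + a * hA2 + h2b)
    rw [map_sub, map_one, sub_eq_zero] at this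
    rw [hB_eq, this, one_smul, add_sub_cancel]
  · have hB3 : (B - 1).det = 3 := by simpa using hB'
    have := hp (a ^ 2 - 1) (by
      push_cast
      linear_combination -hdet + hB3 - a ^ 2 * hA3 - hsq _ _ hb hb - a * hsq _ _ hb hAt)
    rw [map_sub, map_one, map_pow, sub_eq_zero, sq_eq_one_iff] at this
    rcases this with h | h
    · left
      rw [hB_eq, h, one_smul, add_sub_cancel]
    · right
      rw [hB_eq, h]
      have : φ.mapMatrix A * (1 + (-1 : k) • (φ.mapMatrix A - 1))
          = 1 - (φ.mapMatrix A - 1) ^ 2 := by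
        rw [neg_one_smul]; noncomm_ring
      rw [this, hsqA, sub_zero]

end Unipotent

section WittVector

variable {p : ℕ} [Fact p.Prime] {k : Type*}

theorem wittReduce_truncate [CommRing k] (w : WittVector p k) :
    wittReduce p k (WittVector.truncate 2 w) = w.coeff 0 :=
  RingHom.liftOfRightInverse_comp_apply (WittVector.truncate 2) _ _ _ w

theorem wittReduce_surjective [CommRing k] : Function.Surjective (wittReduce p k) := fun x =>
  ⟨WittVector.truncate 2 (WittVector.teichmuller p x), by simp [wittReduce_truncate]⟩

theorem mul_eq_zero_of_wittReduce_eq_zero [CommRing k] [CharP k p]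
    (x y : TruncatedWittVector p 2 k) (hx : wittReduce p k x = 0) (hy : wittReduce p k y = 0) :
    x * y = 0 := by
  obtain ⟨v, rfl⟩ := WittVector.truncate_surjective p 2 k x
  obtain ⟨w, rfl⟩ := WittVector.truncate_surjective p 2 k y
  rw [wittReduce_truncate] at hx hy
  have hV {u : WittVector p k} (hu : u.coeff 0 = 0) :
      u = WittVector.verschiebung (u.shift 1) :=
    WittVector.eq_iterate_verschiebung (n := 1) (by simpa using hu)
  rw [← map_mul, ← RingHom.mem_ker, WittVector.mem_ker_truncate]
  intro i hi
  rw [hV hx, hV hy]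
  have := WittVector.iterate_verschiebung_mul (v.shift 1) (w.shift 1) 1 1
  simp only [Function.iterate_one] at this
  rw [this]
  exact WittVector.iterate_verschiebung_coeff_eq_zero _ hi

theorem wittReduce_eq_zero_of_natCast_mul_eq_zero [Field k] [CharP k p]
    (r : TruncatedWittVector p 2 k) (h : (p : TruncatedWittVector p 2 k) * r = 0) :
    wittReduce p k r = 0 := by
  obtain ⟨w, rfl⟩ := WittVector.truncate_surjective p 2 k r
  rw [← map_natCast (WittVector.truncate (p := p) (R := k) 2), ← map_mul, ← RingHom.mem_ker,
    WittVector.mem_ker_truncate] at h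
  have h1 := h 1 one_lt_two
  rw [mul_comm, WittVector.mul_charP_coeff_succ w 0] at h1
  rw [wittReduce_truncate]
  exact eq_zero_of_pow_eq_zero h1

end WittVector

theorem exists_injective_zmod_prod_zmod_to_GL (p : ℕ) [Fact p.Prime] :
    ∃ f : Multiplicative (ZMod p) × Multiplicative (ZMod p) →* GL (Fin 2) (GaloisField p 2),
      Function.Injective f := by
  have e : (ZMod p × ZMod p) ≃ₗ[ZMod p] GaloisField p 2 :=
    LinearEquiv.ofFinrankEq _ _ (by simp [GaloisField.finrank])
  let F : Multiplicative (GaloisField p 2) →* GL (Fin 2) (GaloisField p 2) :=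
    AddChar.toMonoidHom GeneralLinearGroup.upperRightHom
  refine ⟨F.comp ((AddMonoidHom.toMultiplicative e.toAddEquiv.toAddMonoidHom).comp
    (MulEquiv.prodMultiplicative (ZMod p) (ZMod p)).symm.toMonoidHom), ?_⟩
  exact GeneralLinearGroup.injective_upperRightHom.comp
    (e.injective.comp (MulEquiv.prodMultiplicative (ZMod p) (ZMod p)).symm.injective)

/-- there is an injective homomorphism `ℤ/pℤ × ℤ/pℤ → GL_2(𝔽_{p²})`, and no
injective such homomorphism lifts to `GL_2(W₂(𝔽_{p²}))`. -/
theorem zmod_p_times_zmod_p_no_lift (p : ℕ) [Fact p.Prime] :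
    (∃ f : Multiplicative (ZMod p) × Multiplicative (ZMod p) →* GL (Fin 2) (GaloisField p 2),
      Function.Injective f) ∧
    ∀ f : Multiplicative (ZMod p) × Multiplicative (ZMod p) →* GL (Fin 2) (GaloisField p 2),
      Function.Injective f →
      ¬ ∃ g : Multiplicative (ZMod p) × Multiplicative (ZMod p) →*
            GL (Fin 2) (TruncatedWittVector p 2 (GaloisField p 2)),
          (Matrix.GeneralLinearGroup.map (wittReduce p (GaloisField p 2))).comp g = f := by
  refine ⟨exists_injective_zmod_prod_zmod_to_GL p, ?_⟩
  rintro f hf ⟨g, rfl⟩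
  set F := (Matrix.GeneralLinearGroup.map (n := Fin 2) (wittReduce p (GaloisField p 2))).comp g
  let x : Multiplicative (ZMod p) × Multiplicative (ZMod p) := (Multiplicative.ofAdd 1, 1)
  let y : Multiplicative (ZMod p) × Multiplicative (ZMod p) := (1, Multiplicative.ofAdd 1)
  have hone : Multiplicative.ofAdd (1 : ZMod p) ≠ 1 := by simp
  have hpow : Multiplicative.ofAdd (1 : ZMod p) ^ p = 1 := by
    rw [← ofAdd_nsmul, nsmul_one, CharP.cast_eq_zero, ofAdd_zero]
  have hF (z) : (wittReduce p (GaloisField p 2)).mapMatrix (g z).val = (F z).val := rfl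
  have hne {z} (hz : z ≠ 1) : (F z).val ≠ 1 := by
    rwa [← Units.val_one, Units.val_injective.ne_iff, ← map_one F, hf.ne_iff]
  have hg {z} (hz : z ^ p = 1) : (g z).val ^ p = 1 := by
    rw [← Units.val_pow_eq_pow_val, ← map_pow, hz, map_one, Units.val_one]
  have hcomm : Commute (g x).val (g y).val :=
    ((Commute.all x y).map g).units_val
  rcases map_eq_or_mul_eq_one_of_commute (p := p) wittReduce_surjective
    mul_eq_zero_of_wittReduce_eq_zero wittReduce_eq_zero_of_natCast_mul_eq_zero hcomm
    (hg (Prod.ext hpow (one_pow p))) (hg (Prod.ext (one_pow p) hpow))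
    (hne fun h => hone (congrArg Prod.fst h)) (hne fun h => hone (congrArg Prod.snd h))
    with h | h
  · rw [hF, hF, Units.val_inj, hf.eq_iff] at h
    exact hone (congrArg Prod.snd h)
  · rw [hF, hF, ← Units.val_mul, Units.val_eq_one, ← map_mul, ← map_one F, hf.eq_iff] at h
    exact hone (by simpa [x, y] using congrArg Prod.fst h)
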